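/- Let S_⋆ ∈ {S, S_m, S_s} and let ζ : 𝕏 → P(Ω) be a universally measurable map with ζ(x) ∈ tilde-S_⋆(x) for all x ∈ 𝕏. Then there exists a policy π such that ρ_x[π] = ζ(x) for all x ∈ 𝕏; for S_⋆ = S_m (resp. S_⋆ = S_s) the policy π can be taken semi-Markov (resp. semi-stationary). If, in addition, ζ(x) ∈ tilde-S'_⋆(x) for all x ∈ 𝕏, then π can be taken to be nonrandomized. -/

import Mathlib

open MeasureTheory ProbabilityTheory Filter
open scoped ENNReal NNReal Topology

noncomputable section

namespace PaperStmt

/-- The Borel σ-algebra of the topology of weak convergence on the space of Borel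
probability measures. -/
instance instMeasProb {Ω : Type*} [MeasurableSpace Ω] [TopologicalSpace Ω]
    [OpensMeasurableSpace Ω] : MeasurableSpace (ProbabilityMeasure Ω) := borel _

/-- A set is universally measurable if it is measurable with respect to the completion of
every Borel probability measure. -/
def UniversallyMeasurableSet {α : Type*} [MeasurableSpace α] (s : Set α) : Prop :=
  ∀ μ : Measure α, IsProbabilityMeasure μ → NullMeasurableSet s μ

/-- A map between measurable spaces is universally measurable if preimages of measurable
sets are universally measurable. -/
def UniversallyMeasurable {α β : Type*} [MeasurableSpace α] [MeasurableSpace β]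
    (f : α → β) : Prop :=
  ∀ s : Set β, MeasurableSet s → UniversallyMeasurableSet (f ⁻¹' s)

/-- A function into the extended reals is lower semianalytic if all its sublevel sets are
analytic. -/
def LowerSemianalytic {γ : Type*} [TopologicalSpace γ] (f : γ → EReal) : Prop :=
  ∀ r : ℝ, MeasureTheory.AnalyticSet {x | f x ≤ (r : EReal)}

/-- Lower semianalyticity on a given (analytic) domain. -/
def LowerSemianalyticOn {γ : Type*} [TopologicalSpace γ] (D : Set γ) (f : γ → EReal) : Prop :=
  ∀ r : ℝ, MeasureTheory.AnalyticSet {x | x ∈ D ∧ f x ≤ (r : EReal)}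

/-- Upper semianalyticity on a given (analytic) domain. -/
def UpperSemianalyticOn {γ : Type*} [TopologicalSpace γ] (D : Set γ) (f : γ → EReal) : Prop :=
  ∀ r : ℝ, MeasureTheory.AnalyticSet {x | x ∈ D ∧ (r : EReal) ≤ f x}

/-- The nonnegative part of an extended real number, as an element of `ℝ≥0∞`. -/
def ePos (y : EReal) : ℝ≥0∞ := if y = ⊤ then ⊤ else ENNReal.ofReal y.toReal

/-- The integral `∫ f⁺ dμ - ∫ f⁻ dμ` of an extended-real-valued function, with the
convention `∞ - ∞ = ∞`. -/
def eint {γ : Type*} [MeasurableSpace γ] (μ : Measure γ) (f : γ → EReal) : EReal :=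
  if (∫⁻ x, ePos (f x) ∂μ) = ⊤ then ⊤
  else ((∫⁻ x, ePos (f x) ∂μ : ℝ≥0∞) : EReal) - ((∫⁻ x, ePos (-f x) ∂μ : ℝ≥0∞) : EReal)

/-- Finite sums of extended reals, with the convention `∞ - ∞ = ∞`. -/
def esum {n : ℕ} (v : Fin n → EReal) : EReal :=
  if (∑ i, ePos (v i)) = ⊤ then ⊤
  else ((∑ i, ePos (v i) : ℝ≥0∞) : EReal) - ((∑ i, ePos (-v i) : ℝ≥0∞) : EReal)

/-- The space `H_n = (𝕏 × 𝔸)ⁿ × 𝕏` of histories `h_n = (x_0,a_0,…,x_n)`. -/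
abbrev Hist (X A : Type*) (n : ℕ) := (Fin n → X × A) × X

/-- The sample space `Ω = (𝕏 × 𝔸)^∞`. -/
abbrev Traj (X A : Type*) := ℕ → X × A

/-- The initial state `x_0` of a history. -/
def firstState {X A : Type*} : ∀ {n : ℕ}, Hist X A n → X
  | 0, h => h.2
  | _ + 1, h => (h.1 0).1

/-- A universally measurable policy for the MDP with control constraint `Acts`. -/
structure Policy {X A : Type*} [MeasurableSpace X] [MeasurableSpace A]
    (Acts : X → Set A) where
  μ : ∀ n : ℕ, Hist X A n → Measure A
  isProb : ∀ n h, IsProbabilityMeasure (μ n h)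
  umeas : ∀ (n : ℕ) (B : Set A), MeasurableSet B →
    UniversallyMeasurable fun h : Hist X A n => μ n h B
  feasible : ∀ n h, μ n h (Acts h.2) = 1

namespace Policy

variable {X A : Type*} [MeasurableSpace X] [MeasurableSpace A] {Acts : X → Set A}

/-- Nonrandomized policies: every decision is a Dirac measure. -/
def Nonrandomized (π : Policy Acts) : Prop :=
  ∀ n h, ∃ a : A, π.μ n h = Measure.dirac a

/-- Markov policies: the decision depends only on the current state. -/
def Markov (π : Policy Acts) : Prop :=
  ∃ m : ℕ → X → Measure A, ∀ n h, π.μ n h = m n h.2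

/-- Stationary policies. -/
def Stationary (π : Policy Acts) : Prop :=
  ∃ m : X → Measure A, ∀ n h, π.μ n h = m h.2

/-- Semi-Markov policies: the decision depends only on `(x_0, x_n)`. -/
def SemiMarkov (π : Policy Acts) : Prop :=
  ∃ m : ℕ → X × X → Measure A, ∀ n h, π.μ n h = m n (firstState h, h.2)

/-- Semi-stationary policies. -/
def SemiStationary (π : Policy Acts) : Prop :=
  ∃ m : X × X → Measure A, ∀ n h, π.μ n h = m (firstState h, h.2)

end Policy

variable {X A : Type*} [MeasurableSpace X] [MeasurableSpace A]

/-- The iterated integral giving the finite-dimensional distributions of the process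
induced by an initial distribution, the transition kernel and a policy. -/
def histInt (p0 : Measure X) (q : Kernel (X × A) X)
    (ν : ∀ n : ℕ, Hist X A n → Measure A) :
    ∀ n : ℕ, (Hist X A n → ℝ≥0∞) → ℝ≥0∞
  | 0, f => ∫⁻ x, f (Fin.elim0, x) ∂p0
  | n + 1, f => histInt p0 q ν n fun h =>
      ∫⁻ a, ∫⁻ y, f (Fin.snoc h.1 (h.2, a), y) ∂(q (h.2, a)) ∂(ν n h)

/-- `Induces q π p0 p` says that `p` is (the restriction to the Borel σ-algebra of) the
strategic measure `ρ_{p0}[π]`, i.e. `p` has the finite-dimensional distributions generated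
by `p0`, the policy `π`, and the transition kernel `q`. -/
def Induces (q : Kernel (X × A) X) {Acts : X → Set A} (π : Policy Acts)
    (p0 : Measure X) (p : Measure (Traj X A)) : Prop :=
  ∀ (n : ℕ) (B : Set (Hist X A n)), MeasurableSet B →
    p {ω : Traj X A | ((fun i : Fin n => ω i.val), (ω n).1) ∈ B}
      = histInt p0 q π.μ n (B.indicator fun _ => 1)

/-- The set of strategic measures induced by policies in the class `C` (over all initial
distributions). -/
def SOf (q : Kernel (X × A) X) (Acts : X → Set A) (C : Policy Acts → Prop) :
    Set (ProbabilityMeasure (Traj X A)) :=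
  {p | ∃ (π : Policy Acts) (p0 : ProbabilityMeasure X),
    C π ∧ Induces q π p0.toMeasure p.toMeasure}

variable [TopologicalSpace X] [BorelSpace X] [TopologicalSpace A] [BorelSpace A]

/-- The section `tilde-S_⋆(x)`: strategic measures in the class with initial distribution `δ_x`. -/
def tsec (q : Kernel (X × A) X) (Acts : X → Set A) (C : Policy Acts → Prop) (x : X) :
    Set (ProbabilityMeasure (Traj X A)) :=
  {p | p ∈ SOf q Acts C ∧ p.toMeasure.map (fun ω => (ω 0).1) = Measure.dirac x}

/-- The set `tilde-S_⋆ ⊂ 𝕏 × P(Ω)`. -/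
def tset (q : Kernel (X × A) X) (Acts : X → Set A) (C : Policy Acts → Prop) :
    Set (X × ProbabilityMeasure (Traj X A)) :=
  {xp | xp.2 ∈ tsec q Acts C xp.1}

end PaperStmt

namespace PaperStmt

section UniversalMeasurability

variable {α β : Type*} [MeasurableSpace α] [MeasurableSpace β]

theorem UniversallyMeasurableSet.preimage {f : α → β} (hf : Measurable f) {s : Set β}
    (hs : UniversallyMeasurableSet s) : UniversallyMeasurableSet (f ⁻¹' s) := fun μ _ =>
  (hs (μ.map f) (Measure.isProbabilityMeasure_map hf.aemeasurable)).preimage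
    (hf.quasiMeasurePreserving _)

/-- A copy of `α` carrying the σ-algebra of universally measurable sets. -/
def UM (α : Type*) : Type _ := α

instance : MeasurableSpace (UM α) where
  MeasurableSet' s := UniversallyMeasurableSet (α := α) s
  measurableSet_empty _ _ := nullMeasurableSet_empty
  measurableSet_compl _ hs μ hμ := (hs μ hμ).compl
  measurableSet_iUnion _ hs μ hμ := NullMeasurableSet.iUnion fun i => hs i μ hμ

theorem universallyMeasurable_iff {f : α → β} :
    UniversallyMeasurable f ↔ Measurable (α := UM α) f :=
  ⟨fun h _ hs => h _ hs, fun h _ hs => h hs⟩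

theorem measurable_UM_map {f : α → β} (hf : Measurable f) :
    Measurable (α := UM α) (β := UM β) f :=
  fun _ hs => UniversallyMeasurableSet.preimage hf hs

theorem measurable_UM_id : Measurable (α := UM α) (β := α) id :=
  fun _ hs _ _ => hs.nullMeasurableSet

theorem UniversallyMeasurable.comp_measurable {γ : Type*} [MeasurableSpace γ] {g : β → γ}
    (hg : UniversallyMeasurable g) {f : α → β} (hf : Measurable f) :
    UniversallyMeasurable fun x => g (f x) :=
  fun s hs => (hg s hs).preimage hf

theorem UniversallyMeasurable.aemeasurable [MeasurableSpace.CountablyGenerated β] {f : α → β}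
    (hf : UniversallyMeasurable f) (μ : Measure α) [IsProbabilityMeasure μ] :
    AEMeasurable f μ :=
  NullMeasurable.aemeasurable fun s hs => hf s hs μ inferInstance

end UniversalMeasurability

section Analytic

/-- Points of Baire space whose first `n` coordinates are bounded by those of `m`. -/
def boundedUpTo (m : ℕ → ℕ) (n : ℕ) : Set (ℕ → ℕ) := {x | ∀ i < n, x i ≤ m i}

theorem exists_lt_measure_image_boundedUpTo {α : Type*} [MeasurableSpace α] (μ : Measure α)
    (f : (ℕ → ℕ) → α) {c : ℝ≥0∞} (hc : c < μ (Set.range f)) :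
    ∃ m : ℕ → ℕ, ∀ n, c < μ (f '' boundedUpTo m n) := by
  have step : ∀ (n : ℕ) (m : ℕ → ℕ), c < μ (f '' boundedUpTo m n) →
      ∃ k, c < μ (f '' boundedUpTo (Function.update m n k) (n + 1)) := by
    intro n m h
    have hEq : ∀ k, boundedUpTo (Function.update m n k) (n + 1)
        = boundedUpTo m n ∩ {x | x n ≤ k} := by
      intro k
      ext x
      simp only [boundedUpTo, Set.mem_ofPred_eq, Set.mem_inter_iff]
      constructor
      · intro hx
        refine ⟨fun i hi => ?_, ?_⟩
        · simpa [Function.update_of_ne hi.ne] using hx i (hi.trans (Nat.lt_succ_self n))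
        · simpa using hx n (Nat.lt_succ_self n)
      · rintro ⟨h1, h2⟩ i hi
        rcases (Nat.lt_succ_iff_lt_or_eq.1 hi) with hi | rfl
        · simpa [Function.update_of_ne hi.ne] using h1 i hi
        · simpa using h2
    have hU : f '' boundedUpTo m n = ⋃ k, f '' (boundedUpTo m n ∩ {x | x n ≤ k}) := by
      rw [← Set.image_iUnion, ← Set.inter_iUnion]
      congr 1
      refine (Set.inter_eq_left.2 fun x _ => Set.mem_iUnion.2 ⟨x n, le_refl (x n)⟩).symm
    have hmono : Monotone fun k => f '' (boundedUpTo m n ∩ {x | x n ≤ k}) := fun k l hkl =>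
      Set.image_mono (Set.inter_subset_inter_right _ fun x (hx : x n ≤ k) => hx.trans hkl)
    rw [hU, hmono.measure_iUnion] at h
    obtain ⟨k, hk⟩ := lt_iSup_iff.1 h
    exact ⟨k, by rwa [hEq]⟩
  choose! k hk using step
  let M : ℕ → ℕ → ℕ := fun n => Nat.rec (fun _ => 0) (fun n m => Function.update m n (k n m)) n
  have hM : ∀ n, M (n + 1) = Function.update (M n) n (k n (M n)) := fun n => rfl
  have hlt : ∀ n, c < μ (f '' boundedUpTo (M n) n) := by
    intro n
    induction n with
    | zero => simpa [boundedUpTo] using hc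
    | succ n ih => rw [hM]; exact hk n (M n) ih
  have hstab : ∀ i n, i < n → M n i = M (i + 1) i := by
    intro i n hi
    induction n, hi using Nat.le_induction with
    | base => rfl
    | succ n hn ih =>
      rw [hM, Function.update_of_ne (Nat.ne_of_lt hn), ih]
  refine ⟨fun i => M (i + 1) i, fun n => ?_⟩
  have : boundedUpTo (fun i => M (i + 1) i) n = boundedUpTo (M n) n := by
    ext x
    exact forall₂_congr fun i hi => by rw [hstab i n hi]
  rw [this]
  exact hlt n

variable {α : Type*} [TopologicalSpace α]

theorem isCompact_bounded (m : ℕ → ℕ) : IsCompact {x : ℕ → ℕ | ∀ i, x i ≤ m i} := by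
  have : {x : ℕ → ℕ | ∀ i, x i ≤ m i} = Set.univ.pi fun i => Set.Iic (m i) := by
    ext x; simp [Pi.le_def]
  rw [this]
  exact isCompact_univ_pi fun i => (Set.finite_Iic (m i)).isCompact

theorem exists_image_boundedUpTo_subset {f : (ℕ → ℕ) → α} (hf : Continuous f) (m : ℕ → ℕ)
    {U : Set α} (hU : IsOpen U) (hK : f '' {x | ∀ i, x i ≤ m i} ⊆ U) :
    ∃ n, f '' boundedUpTo m n ⊆ U := by
  by_contra! h
  have h' : ∀ n, ∃ x ∈ boundedUpTo m n, f x ∉ U := fun n => by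
    obtain ⟨_, ⟨x, hx, rfl⟩, hxU⟩ := Set.not_subset.1 (h n)
    exact ⟨x, hx, hxU⟩
  choose x hx hxU using h'
  obtain ⟨y, hy, φ, hφ, hlim⟩ := (isCompact_bounded m).tendsto_subseq
    (x := fun n i => min (x n i) (m i)) fun n i => min_le_right _ _
  have hlim' : Tendsto (x ∘ φ) atTop (𝓝 y) := by
    rw [tendsto_pi_nhds] at hlim ⊢
    intro i
    refine (hlim i).congr' ?_
    filter_upwards [eventually_gt_atTop i] with k hk
    exact min_eq_left (hx (φ k) i (hk.trans_le (hφ.id_le k)))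
  have hyU : f y ∈ U := hK ⟨y, hy, rfl⟩
  obtain ⟨k, hk⟩ := (((hf.tendsto y).comp hlim').eventually (hU.mem_nhds hyU)).exists
  exact hxU _ hk

theorem iInter_closure_image_boundedUpTo [T2Space α] {f : (ℕ → ℕ) → α}
    (hf : Continuous f) (m : ℕ → ℕ) :
    ⋂ n, closure (f '' boundedUpTo m n) ⊆ f '' {x | ∀ i, x i ≤ m i} := by
  intro y hy
  by_contra hyK
  obtain ⟨U, V, hU, hV, hKU, hyV, hUV⟩ := SeparatedNhds.of_isCompact_isCompact
    ((isCompact_bounded m).image hf) isCompact_singleton (Set.disjoint_singleton_right.2 hyK)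
  obtain ⟨n, hn⟩ := exists_image_boundedUpTo_subset hf m hU hKU
  have hyn := closure_mono hn (Set.mem_iInter.1 hy n)
  exact Set.disjoint_left.1 (hUV.closure_left hV) hyn (hyV rfl)

variable [T2Space α] [MeasurableSpace α] [OpensMeasurableSpace α]

/-- Inner regularity of analytic sets with respect to compact sets. -/
theorem exists_isCompact_image_measure_ge (μ : Measure α) [IsFiniteMeasure μ]
    {f : (ℕ → ℕ) → α} (hf : Continuous f) {c : ℝ≥0∞} (hc : c < μ (Set.range f)) :
    ∃ K ⊆ Set.range f, IsCompact K ∧ c ≤ μ K := by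
  obtain ⟨m, hm⟩ := exists_lt_measure_image_boundedUpTo μ f hc
  refine ⟨f '' {x | ∀ i, x i ≤ m i}, Set.image_subset_range _ _,
    (isCompact_bounded m).image hf, ?_⟩
  have hanti : Antitone fun n => closure (f '' boundedUpTo m n) := fun k l hkl =>
    closure_mono (Set.image_mono fun x hx i hi => hx i (hi.trans_le hkl))
  refine le_trans ?_ (measure_mono (iInter_closure_image_boundedUpTo hf m))
  rw [hanti.measure_iInter (fun n => isClosed_closure.measurableSet.nullMeasurableSet)
    ⟨0, measure_ne_top _ _⟩]
  exact le_iInf fun n => (hm n).le.trans (measure_mono subset_closure)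

theorem _root_.MeasureTheory.AnalyticSet.universallyMeasurableSet {s : Set α}
    (hs : AnalyticSet s) : UniversallyMeasurableSet s := by
  intro μ _
  rw [AnalyticSet] at hs
  rcases hs with rfl | ⟨f, hf, rfl⟩
  · exact nullMeasurableSet_empty
  rcases eq_or_ne (μ (Set.range f)) 0 with h0 | h0
  · exact NullMeasurableSet.of_null h0
  obtain ⟨c, -, hc, hlim⟩ := exists_seq_strictMono_tendsto' (pos_iff_ne_zero.2 h0)
  choose K hKs hK hcK using fun n => exists_isCompact_image_measure_ge μ hf (hc n).2
  have hmeas : MeasurableSet (⋃ n, K n) :=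
    MeasurableSet.iUnion fun n => (hK n).isClosed.measurableSet
  have hle : μ (Set.range f) ≤ μ (⋃ n, K n) := le_of_tendsto' hlim fun n =>
    (hcK n).trans (measure_mono (Set.subset_iUnion K n))
  exact hmeas.nullMeasurableSet.congr
    (ae_eq_of_subset_of_measure_ge (Set.iUnion_subset hKs) hle hmeas.nullMeasurableSet
      (measure_ne_top _ _))

end Analytic

section UMKernel

variable {Z A : Type*} [MeasurableSpace Z] [MeasurableSpace A]

/-- Universally measurable stochastic kernels. -/
structure IsUMKernel (κ : Z → Measure A) : Prop where
  isProb : ∀ z, IsProbabilityMeasure (κ z)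
  umeas : ∀ B : Set A, MeasurableSet B → UniversallyMeasurable fun z => κ z B

theorem IsUMKernel.comp {W : Type*} [MeasurableSpace W] {κ : Z → Measure A} (hκ : IsUMKernel κ)
    {f : W → Z} (hf : Measurable f) : IsUMKernel fun w => κ (f w) :=
  ⟨fun w => hκ.isProb (f w), fun B hB => (hκ.umeas B hB).comp_measurable hf⟩

/-- A universally measurable kernel is a Borel kernel on the universal completion. -/
def IsUMKernel.toKernel {κ : Z → Measure A} (hκ : IsUMKernel κ) : Kernel (UM Z) A :=
  @Kernel.mk (UM Z) A _ _ κ <| Measure.measurable_of_measurable_coe (β := UM Z) κ fun B hB =>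
    (universallyMeasurable_iff (α := Z)).1 (hκ.umeas B hB)

instance {κ : Z → Measure A} (hκ : IsUMKernel κ) : IsMarkovKernel hκ.toKernel :=
  ⟨fun z => hκ.isProb z⟩

theorem exists_countable_isPiSystem_generateFrom (A : Type*) [m : MeasurableSpace A]
    [MeasurableSpace.CountablyGenerated A] :
    ∃ S : Set (Set A), S.Countable ∧ IsPiSystem S ∧ m = MeasurableSpace.generateFrom S :=
  ⟨generateSetAlgebra (MeasurableSpace.countableGeneratingSet A),
    countable_generateSetAlgebra MeasurableSpace.countable_countableGeneratingSet,
    fun _ hs _ ht _ => isSetAlgebra_generateSetAlgebra.inter_mem hs ht, by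
      rw [generateFrom_generateSetAlgebra_eq, MeasurableSpace.generateFrom_countableGeneratingSet]⟩

theorem aemeasurable_kernel_section {S : Set (Z × A)}
    (hS : UniversallyMeasurableSet S) (κ : Kernel Z A) [IsMarkovKernel κ] (μ : Measure Z)
    [IsProbabilityMeasure μ] : AEMeasurable (fun z => κ z (Prod.mk z ⁻¹' S)) μ := by
  have hT := hS (μ ⊗ₘ κ) inferInstance
  have hm := measurableSet_toMeasurable (μ ⊗ₘ κ) S
  refine ⟨fun z => κ z (Prod.mk z ⁻¹' toMeasurable (μ ⊗ₘ κ) S),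
    Kernel.measurable_kernel_prodMk_left hm, ?_⟩
  filter_upwards [Measure.ae_ae_of_ae_compProd hT.toMeasurable_ae_eq] with z hz
  exact measure_congr (hz.mono fun a ha => ha.symm)

/-- A probability measure is a Dirac mass as soon as it takes values in `{0, 1}` on a countable
generating π-system. -/
theorem exists_eq_dirac_iff_of_isPiSystem {A : Type*} {mA : MeasurableSpace A} {S : Set (Set A)}
    (hSc : S.Countable) (hSpi : IsPiSystem S) (hgen : mA = MeasurableSpace.generateFrom S)
    (μ : Measure A) [IsProbabilityMeasure μ] :
    (∃ a, μ = Measure.dirac a) ↔ ∀ s ∈ S, μ s = 0 ∨ μ s = 1 := by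
  have hSm : ∀ s ∈ S, MeasurableSet s := fun s hs => by
    rw [hgen]; exact MeasurableSpace.measurableSet_generateFrom hs
  constructor
  · rintro ⟨a, rfl⟩ s hs
    rw [Measure.dirac_apply' _ (hSm s hs)]
    by_cases ha : a ∈ s <;> simp [ha]
  · intro h
    have hae : ∀ᵐ a ∂μ, ∀ s ∈ S, μ s = Measure.dirac a s :=
      (ae_ball_iff hSc).2 fun s hs => by
        rcases h s hs with h0 | h1
        · filter_upwards [measure_eq_zero_iff_ae_notMem.1 h0] with a ha
          rw [Measure.dirac_apply' _ (hSm s hs)]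
          simp [h0, ha]
        · filter_upwards [(prob_compl_eq_zero_iff (hSm s hs)).2 h1] with a ha
          rw [Measure.dirac_apply' _ (hSm s hs)]
          simp [h1, Set.indicator_of_mem ha]
    obtain ⟨a, ha⟩ := hae.exists
    exact ⟨a, ext_of_generate_finite S hgen hSpi ha (by simp)⟩

theorem IsUMKernel.piecewise {κ η : Z → Measure A} (hκ : IsUMKernel κ) (hη : IsUMKernel η)
    {G : Set Z} (hG : UniversallyMeasurableSet G) [∀ z, Decidable (z ∈ G)] :
    IsUMKernel (G.piecewise κ η) where
  isProb z := by
    by_cases hz : z ∈ G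
    · simpa [hz] using hκ.isProb z
    · simpa [hz] using hη.isProb z
  umeas B hB := by
    have : (fun z => G.piecewise κ η z B) = G.piecewise (fun z => κ z B) fun z => η z B := by
      ext z
      by_cases hz : z ∈ G <;> simp [hz]
    rw [this]
    exact universallyMeasurable_iff.2 (Measurable.piecewise (α := UM Z) hG
      (universallyMeasurable_iff.1 (hκ.umeas B hB)) (universallyMeasurable_iff.1 (hη.umeas B hB)))

variable [MeasurableSpace.CountablyGenerated A]

theorem IsUMKernel.exists_kernel_ae_eq {κ : Z → Measure A} (hκ : IsUMKernel κ) (μ : Measure Z)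
    [IsProbabilityMeasure μ] : ∃ κ' : Kernel Z A, IsMarkovKernel κ' ∧ κ =ᵐ[μ] κ' := by
  classical
  obtain ⟨S, hSc, hSpi, hgen⟩ := exists_countable_isPiSystem_generateFrom A
  have hSm : ∀ s ∈ S, MeasurableSet s := fun s hs => by
    rw [hgen]; exact MeasurableSpace.measurableSet_generateFrom hs
  have : Countable S := hSc
  have hae : ∀ s : S, AEMeasurable (fun z => κ z s) μ := fun s =>
    (hκ.umeas s (hSm s s.2)).aemeasurable μ
  have hall : ∀ᵐ z ∂μ, ∀ s : S, κ z s = (hae s).mk _ z := ae_all_iff.2 fun s => (hae s).ae_eq_mk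
  obtain ⟨G, hG, hGm, hGsub⟩ := hall.exists_measurable_mem
  obtain ⟨z₀, -⟩ := Filter.Eventually.exists (f := ae μ) (p := (· ∈ G)) hG
  have hprob : ∀ z, IsProbabilityMeasure (if z ∈ G then κ z else κ z₀) := fun z => by
    split_ifs <;> exact hκ.isProb _
  refine ⟨⟨fun z => if z ∈ G then κ z else κ z₀, ?_⟩, ⟨hprob⟩, ?_⟩
  · refine Measurable.measure_of_isPiSystem_of_isProbabilityMeasure hgen hSpi fun s hs => ?_
    have : (fun z => (if z ∈ G then κ z else κ z₀) s)
        = G.piecewise ((hae ⟨s, hs⟩).mk _) fun _ => κ z₀ s := by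
      ext z
      by_cases hz : z ∈ G
      · simpa [hz] using hGsub z hz ⟨s, hs⟩
      · simp [hz]
    rw [this]
    exact (hae ⟨s, hs⟩).measurable_mk.piecewise hGm measurable_const
  · filter_upwards [hG] with z hz
    exact (if_pos hz).symm

theorem IsUMKernel.universallyMeasurable_section {κ : Z → Measure A} (hκ : IsUMKernel κ)
    {S : Set (Z × A)} (hS : UniversallyMeasurableSet S) :
    UniversallyMeasurable fun z => κ z (Prod.mk z ⁻¹' S) := by
  intro B hB μ _
  obtain ⟨κ', _, h⟩ := hκ.exists_kernel_ae_eq μ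
  have heq : (fun z => κ z (Prod.mk z ⁻¹' S)) =ᵐ[μ] fun z => κ' z (Prod.mk z ⁻¹' S) := by
    filter_upwards [h] with z hz
    rw [hz]
  exact ((aemeasurable_kernel_section hS κ' μ).congr heq.symm).nullMeasurable hB

theorem IsUMKernel.universallyMeasurableSet_dirac {κ : Z → Measure A} (hκ : IsUMKernel κ) :
    UniversallyMeasurableSet {z | ∃ a, κ z = Measure.dirac a} := by
  obtain ⟨S, hSc, hSpi, hgen⟩ := exists_countable_isPiSystem_generateFrom A
  have hEq : {z | ∃ a, κ z = Measure.dirac a}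
      = ⋂ s ∈ S, (fun z => κ z s) ⁻¹' ({0, 1} : Set ℝ≥0∞) := by
    ext z
    have := hκ.isProb z
    simp [exists_eq_dirac_iff_of_isPiSystem hSc hSpi hgen]
  rw [hEq]
  intro μ hμ
  refine NullMeasurableSet.biInter hSc fun s hs => hκ.umeas s ?_ _ (by measurability) μ hμ
  rw [hgen]
  exact MeasurableSpace.measurableSet_generateFrom hs

end UMKernel

section Disintegration

variable {X Y A : Type*} [MeasurableSpace X] [MeasurableSpace Y] [MeasurableSpace A]

theorem IsUMKernel.exists_disintegration [MeasurableSpace.CountablyGenerated Y]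
    [StandardBorelSpace A] [Nonempty A] {γ : X → Measure (Y × A)} (hγ : IsUMKernel γ) :
    ∃ κ : X × Y → Measure A, IsUMKernel κ ∧ ∀ (x : X) (η : Kernel Y A), IsMarkovKernel η →
      γ x = (γ x).fst ⊗ₘ η → ∀ᵐ y ∂(γ x).fst, κ (x, y) = η y := by
  let K := hγ.toKernel
  have hid : Measurable (α := UM (X × Y)) (β := UM X × Y) fun z => z :=
    (measurable_UM_map (measurable_fst : Measurable (Prod.fst : X × Y → X))).prodMk
      (measurable_snd.comp (measurable_UM_id (α := X × Y)))
  refine ⟨fun z => K.condKernel (z : X × Y), ⟨fun z => ?_, fun B hB => ?_⟩, fun x η hη h => ?_⟩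
  · have : IsMarkovKernel K.condKernel := inferInstance
    exact this.isProbabilityMeasure _
  · exact universallyMeasurable_iff.2 ((K.condKernel.measurable_coe hB).comp hid)
  · have hprob := hγ.isProb x
    let x' : UM X := x
    have hK : γ x = (γ x).fst ⊗ₘ K.condKernel.sectR x' := by
      have h1 := Kernel.compProd_apply_eq_compProd_sectR K.fst K.condKernel x'
      rw [K.disintegrate, Kernel.fst_apply] at h1
      exact h1
    filter_upwards [eq_condKernel_of_measure_eq_compProd η h,
      eq_condKernel_of_measure_eq_compProd _ hK] with y h1 h2
    exact h2.trans h1.symm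

end Disintegration

section Admissible

variable {X A : Type*} [MeasurableSpace X] [MeasurableSpace A]

/-- A decision rule `m` at state `x` satisfies the control constraint and, if `N` holds, is
nonrandomized. -/
def AdmissibleAt (Acts : X → Set A) (N : Prop) (x : X) (m : Measure A) : Prop :=
  m (Acts x) = 1 ∧ (N → ∃ a, m = Measure.dirac a)

variable {Acts : X → Set A} {N : Prop} {d : X → Measure A}

theorem IsUMKernel.universallyMeasurableSet_admissibleAt [MeasurableSpace.CountablyGenerated A]
    {Z : Type*} [MeasurableSpace Z] (hΓ : UniversallyMeasurableSet {xa : X × A | xa.2 ∈ Acts xa.1})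
    {κ : Z → Measure A} (hκ : IsUMKernel κ) {ψ : Z → X} (hψ : Measurable ψ) :
    UniversallyMeasurableSet {z | AdmissibleAt Acts N (ψ z) (κ z)} := by
  have h1 : UniversallyMeasurableSet {z | κ z (Acts (ψ z)) = 1} :=
    hκ.universallyMeasurable_section
      (hΓ.preimage (f := fun w : Z × A => (ψ w.1, w.2)) (by fun_prop)) {1} (measurableSet_singleton 1)
  by_cases hN : N
  · simp only [AdmissibleAt, hN, forall_const]
    exact fun μ hμ => (h1 μ hμ).inter (hκ.universallyMeasurableSet_dirac μ hμ)
  · simpa only [AdmissibleAt, hN, false_imp_iff, and_true] using h1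

/-- Replace a universally measurable kernel by an admissible one wherever it fails to be so. -/
theorem IsUMKernel.exists_admissible_modification [MeasurableSpace.CountablyGenerated A]
    {Z : Type*} [MeasurableSpace Z] (hΓ : UniversallyMeasurableSet {xa : X × A | xa.2 ∈ Acts xa.1})
    (hd : IsUMKernel d) (hdA : ∀ x, AdmissibleAt Acts N x (d x))
    {κ : Z → Measure A} (hκ : IsUMKernel κ) {ψ : Z → X} (hψ : Measurable ψ) :
    ∃ κ' : Z → Measure A, IsUMKernel κ' ∧ (∀ z, AdmissibleAt Acts N (ψ z) (κ' z)) ∧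
      ∀ z, AdmissibleAt Acts N (ψ z) (κ z) → κ' z = κ z := by
  classical
  let G : Set Z := {z | AdmissibleAt Acts N (ψ z) (κ z)}
  refine ⟨G.piecewise κ fun z => d (ψ z), hκ.piecewise (hd.comp hψ)
    (hκ.universallyMeasurableSet_admissibleAt hΓ hψ), fun z => ?_,
    fun z hz => Set.piecewise_eq_of_mem G κ _ hz⟩
  by_cases hz : z ∈ G
  · rw [Set.piecewise_eq_of_mem _ _ _ hz]; exact hz
  · rw [Set.piecewise_eq_of_notMem _ _ _ hz]; exact hdA _

variable {Y Ω : Type*} [MeasurableSpace Y] [MeasurableSpace Ω]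

/-- The mixture with weights `2⁻¹, 2⁻², …` of the laws of a sequence of random variables. -/
def geomMixture (μ : Measure Ω) (U : ℕ → Ω → Y) : Measure Y :=
  Measure.sum fun j => (2 : ℝ≥0∞)⁻¹ ^ (j + 1) • μ.map (U j)

theorem geomMixture_apply (μ : Measure Ω) {U : ℕ → Ω → Y} (hU : ∀ j, Measurable (U j))
    {B : Set Y} (hB : MeasurableSet B) :
    geomMixture μ U B = ∑' j, (2 : ℝ≥0∞)⁻¹ ^ (j + 1) * μ (U j ⁻¹' B) := by
  simp [geomMixture, Measure.sum_apply _ hB, Measure.map_apply (hU _) hB]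

theorem ae_geomMixture_iff (μ : Measure Ω) (U : ℕ → Ω → Y) {P : Y → Prop} :
    (∀ᵐ y ∂geomMixture μ U, P y) ↔ ∀ j, ∀ᵐ y ∂μ.map (U j), P y := by
  simp only [geomMixture, Measure.ae_sum_iff]
  exact forall_congr' fun j => by rw [Measure.ae_ennreal_smul_measure_iff (by simp)]

theorem IsUMKernel.mixture {p : X → Measure Ω} (hp : IsUMKernel p) {U : ℕ → Ω → Y}
    (hU : ∀ j, Measurable (U j)) : IsUMKernel fun x => geomMixture (p x) U where
  isProb x := ⟨by
    have := hp.isProb x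
    rw [geomMixture_apply _ hU MeasurableSet.univ]
    simp [ENNReal.tsum_geometric_add_one, ENNReal.inv_mul_cancel]⟩
  umeas B hB := by
    simp only [geomMixture_apply _ hU hB]
    exact universallyMeasurable_iff.2 (Measurable.tsum fun j =>
      (universallyMeasurable_iff.1 (hp.umeas _ (hU j hB))).const_mul _)

theorem fst_geomMixture (μ : Measure Ω) {U : ℕ → Ω → Y × A} (hU : ∀ j, Measurable (U j)) :
    (geomMixture μ U).fst = geomMixture μ fun j ω => (U j ω).1 := by
  ext B hB
  rw [Measure.fst_apply hB, geomMixture_apply _ hU (measurable_fst hB),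
    geomMixture_apply _ (fun j => (hU j).fst) hB]
  rfl

theorem geomMixture_compProd (μ : Measure Ω) [IsProbabilityMeasure μ] (U : ℕ → Ω → Y)
    (η : Kernel Y A) [IsMarkovKernel η] :
    geomMixture μ U ⊗ₘ η
      = Measure.sum fun j => (2 : ℝ≥0∞)⁻¹ ^ (j + 1) • (μ.map (U j) ⊗ₘ η) := by
  have (j : ℕ) : SFinite ((2 : ℝ≥0∞)⁻¹ ^ (j + 1) • μ.map (U j)) := inferInstance
  rw [geomMixture, Measure.compProd_sum_left]
  simp only [Measure.compProd_smul_left]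

/-- Simultaneous universally measurable reconstruction of decision rules: one kernel on `X × Y`
recovers, for each `x`, any admissible rule governing all pairs `(U j, V j)` under `p x`. -/
theorem IsUMKernel.exists_admissible_rule [MeasurableSpace.CountablyGenerated Y]
    [StandardBorelSpace A] [Nonempty A]
    (hΓ : UniversallyMeasurableSet {xa : X × A | xa.2 ∈ Acts xa.1})
    (hd : IsUMKernel d) (hdA : ∀ x, AdmissibleAt Acts N x (d x))
    {p : X → Measure Ω} (hp : IsUMKernel p) {U : ℕ → Ω → Y} (hU : ∀ j, Measurable (U j))
    {V : ℕ → Ω → A} (hV : ∀ j, Measurable (V j)) {ψ : Y → X} (hψ : Measurable ψ) :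
    ∃ κ : X × Y → Measure A, IsUMKernel κ ∧ (∀ z, AdmissibleAt Acts N (ψ z.2) (κ z)) ∧
      ∀ (x : X) (m : Y → Measure A), IsUMKernel m → (∀ y, AdmissibleAt Acts N (ψ y) (m y)) →
        (∀ j (η : Kernel Y A), IsMarkovKernel η → m =ᵐ[(p x).map (U j)] η →
          (p x).map (fun ω => (U j ω, V j ω)) = (p x).map (U j) ⊗ₘ η) →
        ∀ j, ∀ᵐ y ∂(p x).map (U j), κ (x, y) = m y := by
  have hUV : ∀ j, Measurable fun ω => (U j ω, V j ω) := fun j => (hU j).prodMk (hV j)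
  obtain ⟨κ₀, hκ₀, hκ₀eq⟩ := (hp.mixture hUV).exists_disintegration
  obtain ⟨κ, hκ, hκA, hκeq⟩ := hd.exists_admissible_modification hΓ hdA hκ₀
    (hψ.comp measurable_snd)
  refine ⟨κ, hκ, hκA, fun x m hm hmA hdis j => ?_⟩
  have := hp.isProb x
  have := (hp.mixture hU).isProb x
  obtain ⟨η, hη, hmη⟩ := hm.exists_kernel_ae_eq (geomMixture (p x) U)
  have hγ := hκ₀eq x η hη (by
    rw [fst_geomMixture _ hUV, geomMixture_compProd, geomMixture]
    congr 1
    ext1 j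
    rw [hdis j η hη ((ae_geomMixture_iff _ _).1 hmη j)])
  rw [fst_geomMixture _ hUV] at hγ
  have hall : ∀ᵐ y ∂geomMixture (p x) U, κ (x, y) = m y := by
    filter_upwards [hγ, hmη] with y h1 h2
    have h3 : κ₀ (x, y) = m y := h1.trans h2.symm
    exact (hκeq (x, y) (by rw [h3]; exact hmA y)).trans h3
  exact (ae_geomMixture_iff _ _).1 hall j

end Admissible

section ProbabilityMeasures

theorem measurable_toMeasure {Ω : Type*} [MeasurableSpace Ω] [TopologicalSpace Ω] [BorelSpace Ω]
    [HasOuterApproxClosed Ω] : Measurable fun p : ProbabilityMeasure Ω => p.toMeasure := by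
  have : OpensMeasurableSpace (ProbabilityMeasure Ω) := ⟨le_rfl⟩
  refine Measurable.measure_of_isPiSystem_of_isProbabilityMeasure
    (BorelSpace.measurable_eq (α := Ω)) isPiSystem_isOpen fun G hG => ?_
  exact (lowerSemicontinuous_iff_le_liminf.2 fun p =>
    ProbabilityMeasure.le_liminf_measure_open_of_tendsto tendsto_id hG).measurable

theorem UniversallyMeasurable.isUMKernel_toMeasure {Z Ω : Type*} [MeasurableSpace Z]
    [MeasurableSpace Ω] [TopologicalSpace Ω] [BorelSpace Ω] [HasOuterApproxClosed Ω]
    {ζ : Z → ProbabilityMeasure Ω} (hζ : UniversallyMeasurable ζ) :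
    IsUMKernel fun z => (ζ z).toMeasure :=
  ⟨fun z => (ζ z).2, fun _ hB => universallyMeasurable_iff.2
    ((Measure.measurable_coe hB).comp (measurable_toMeasure.comp (universallyMeasurable_iff.1 hζ)))⟩

end ProbabilityMeasures

section Induced

/-- The history up to time `n` of a trajectory. -/
def hist {X A : Type*} (n : ℕ) (ω : Traj X A) : Hist X A n := (fun i : Fin n => ω i.val, (ω n).1)

theorem firstState_hist {X A : Type*} (ω : Traj X A) : ∀ n, firstState (hist n ω) = (ω 0).1
  | 0 => rfl
  | _ + 1 => rfl

variable {X A : Type*} [MeasurableSpace X] [MeasurableSpace A]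

theorem measurable_hist (n : ℕ) : Measurable (hist (X := X) (A := A) n) := by
  unfold hist; fun_prop

theorem measurable_firstState : ∀ n, Measurable (firstState : Hist X A n → X)
  | 0 => measurable_snd
  | _ + 1 => by unfold firstState; fun_prop

/-- Append an action and a successor state to a history. -/
def extendHist {n : ℕ} (w : (Hist X A n × A) × X) : Hist X A (n + 1) :=
  (Fin.snoc w.1.1.1 (w.1.1.2, w.1.2), w.2)

theorem measurable_extendHist (n : ℕ) : Measurable (extendHist (X := X) (A := A) (n := n)) := by
  refine Measurable.prodMk (measurable_pi_lambda _ fun i => ?_) measurable_snd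
  induction i using Fin.lastCases with
  | last => simpa only [Fin.snoc_last] using by fun_prop
  | cast i => simpa only [Fin.snoc_castSucc] using by fun_prop

/-- The law of the history after one more transition, when the current history has law `P` and
the action is chosen by `κ`. -/
def histStep (q : Kernel (X × A) X) {n : ℕ} (P : Measure (Hist X A n))
    (κ : Kernel (Hist X A n) A) :
    Measure (Hist X A (n + 1)) :=
  ((P ⊗ₘ κ) ⊗ₘ q.comap (fun w : Hist X A n × A => (w.1.2, w.2)) (by fun_prop)).map extendHist

variable {q : Kernel (X × A) X} {n : ℕ}

variable {Acts : X → Set A} {π : Policy Acts} {p0 : Measure X} {p : Measure (Traj X A)}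

theorem Policy.isUMKernel (π : Policy Acts) (n : ℕ) : IsUMKernel (π.μ n) :=
  ⟨π.isProb n, π.umeas n⟩

theorem Induces.map_hist_zero (h : Induces q π p0 p) :
    p.map (hist 0) = p0.map fun x => (Fin.elim0, x) := by
  ext B hB
  have hm : Measurable fun x : X => ((Fin.elim0, x) : Hist X A 0) := by fun_prop
  rw [Measure.map_apply (measurable_hist 0) hB, Measure.map_apply hm hB]
  refine (h 0 B hB).trans ?_
  rw [← lintegral_indicator_one (hm hB)]
  rfl

variable [IsMarkovKernel q]

theorem lintegral_histStep {P : Measure (Hist X A n)} [IsProbabilityMeasure P]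
    {κ : Kernel (Hist X A n) A} [IsMarkovKernel κ] {ν : Hist X A n → Measure A} (hν : ν =ᵐ[P] κ)
    {f : Hist X A (n + 1) → ℝ≥0∞} (hf : AEMeasurable f (histStep q P κ)) :
    AEMeasurable (fun h : Hist X A n =>
        ∫⁻ a, ∫⁻ y, f (Fin.snoc h.1 (h.2, a), y) ∂q (h.2, a) ∂ν h) P ∧
      ∫⁻ h, ∫⁻ a, ∫⁻ y, f (Fin.snoc h.1 (h.2, a), y) ∂q (h.2, a) ∂ν h ∂P
        = ∫⁻ h, f h ∂histStep q P κ := by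
  let q' : Kernel (Hist X A n × A) X := q.comap (fun w => (w.1.2, w.2)) (by fun_prop)
  have hg : Measurable fun w : (Hist X A n × A) × X => hf.mk f (extendHist w) :=
    hf.measurable_mk.comp (measurable_extendHist n)
  have h1 : Measurable fun w : Hist X A n × A => ∫⁻ y, hf.mk f (extendHist (w, y)) ∂q' w :=
    hg.lintegral_kernel_prod_right'
  have h2 : Measurable fun h => ∫⁻ a, ∫⁻ y, hf.mk f (extendHist ((h, a), y)) ∂q' (h, a) ∂κ h :=
    h1.lintegral_kernel_prod_right'
  have hae : (fun h : Hist X A n => ∫⁻ a, ∫⁻ y, f (Fin.snoc h.1 (h.2, a), y) ∂q (h.2, a) ∂ν h)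
      =ᵐ[P] fun h => ∫⁻ a, ∫⁻ y, hf.mk f (extendHist ((h, a), y)) ∂q' (h, a) ∂κ h := by
    have := Measure.ae_ae_of_ae_compProd (Measure.ae_ae_of_ae_compProd
      (ae_of_ae_map (measurable_extendHist n).aemeasurable hf.ae_eq_mk))
    filter_upwards [this, hν] with h hh hνh
    rw [hνh]
    exact lintegral_congr_ae (hh.mono fun a ha => lintegral_congr_ae ha)
  refine ⟨⟨_, h2, hae⟩, ?_⟩
  rw [lintegral_congr_ae hae, lintegral_congr_ae hf.ae_eq_mk]
  exact ((Measure.lintegral_compProd hg).trans (Measure.lintegral_compProd h1)).symm.trans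
    (lintegral_map hf.measurable_mk (measurable_extendHist n)).symm

theorem Induces.map_hist_succ_of_histInt [IsProbabilityMeasure p] (h : Induces q π p0 p)
    (hn : ∀ f, AEMeasurable f (p.map (hist n)) →
      histInt p0 q π.μ n f = ∫⁻ x, f x ∂p.map (hist n))
    {κ : Kernel (Hist X A n) A} [IsMarkovKernel κ] (hκ : π.μ n =ᵐ[p.map (hist n)] κ) :
    p.map (hist (n + 1)) = histStep q (p.map (hist n)) κ := by
  have := Measure.isProbabilityMeasure_map (μ := p) (measurable_hist n).aemeasurable
  ext B hB
  obtain ⟨h1, h2⟩ := lintegral_histStep (q := q) hκ (f := B.indicator fun _ => 1)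
    (measurable_one.indicator hB).aemeasurable
  rw [Measure.map_apply (measurable_hist _) hB]
  refine (h (n + 1) B hB).trans ((hn _ h1).trans (h2.trans ?_))
  exact lintegral_indicator_one hB

variable [MeasurableSpace.CountablyGenerated A]

theorem Induces.histInt_eq [IsProbabilityMeasure p] (h : Induces q π p0 p) :
    ∀ (n : ℕ) (f : Hist X A n → ℝ≥0∞), AEMeasurable f (p.map (hist n)) →
      histInt p0 q π.μ n f = ∫⁻ x, f x ∂p.map (hist n) := by
  intro n
  induction n with
  | zero =>
    intro f hf
    have hm : Measurable fun x : X => ((Fin.elim0, x) : Hist X A 0) := by fun_prop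
    rw [h.map_hist_zero] at hf ⊢
    exact (lintegral_map' hf hm.aemeasurable).symm
  | succ n ih =>
    intro f hf
    have := Measure.isProbabilityMeasure_map (μ := p) (measurable_hist n).aemeasurable
    obtain ⟨κ, _, hκ⟩ := (π.isUMKernel n).exists_kernel_ae_eq (p.map (hist n))
    rw [h.map_hist_succ_of_histInt ih hκ] at hf ⊢
    obtain ⟨h1, h2⟩ := lintegral_histStep hκ hf
    exact (ih _ h1).trans h2

theorem Induces.map_hist_succ [IsProbabilityMeasure p] (h : Induces q π p0 p)
    {κ : Kernel (Hist X A n) A} [IsMarkovKernel κ] (hκ : π.μ n =ᵐ[p.map (hist n)] κ) :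
    p.map (hist (n + 1)) = histStep q (p.map (hist n)) κ :=
  h.map_hist_succ_of_histInt (h.histInt_eq n) hκ

/-- Policies that agree almost surely along a strategic measure induce the same measure. -/
theorem Induces.congr_ae [IsProbabilityMeasure p] (h : Induces q π p0 p) {π' : Policy Acts}
    (hπ : ∀ n, π'.μ n =ᵐ[p.map (hist n)] π.μ n) : Induces q π' p0 p := by
  have key : ∀ (n : ℕ) (f : Hist X A n → ℝ≥0∞), AEMeasurable f (p.map (hist n)) →
      histInt p0 q π'.μ n f = ∫⁻ x, f x ∂p.map (hist n) := by
    intro n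
    induction n with
    | zero => exact h.histInt_eq 0
    | succ n ih =>
      intro f hf
      have := Measure.isProbabilityMeasure_map (μ := p) (measurable_hist n).aemeasurable
      obtain ⟨κ, _, hκ⟩ := (π.isUMKernel n).exists_kernel_ae_eq (p.map (hist n))
      rw [h.map_hist_succ hκ] at hf ⊢
      obtain ⟨h1, h2⟩ := lintegral_histStep ((hπ n).trans hκ) hf
      exact (ih _ h1).trans h2
  intro n B hB
  refine (Measure.map_apply (measurable_hist n) hB).symm.trans ?_
  refine (lintegral_indicator_one hB).symm.trans (key n _ ?_).symm
  exact (measurable_one.indicator hB).aemeasurable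

/-- If the decision rule at time `n` factors through a feature `φ` of the history, then it
disintegrates the joint law of the feature and the action. -/
theorem Induces.map_prodMk_action [IsProbabilityMeasure p] (h : Induces q π p0 p)
    {Y : Type*} [MeasurableSpace Y] {φ : Hist X A n → Y} (hφ : Measurable φ)
    {η : Kernel Y A} [IsMarkovKernel η]
    (hη : π.μ n =ᵐ[p.map (hist n)] η.comap φ hφ) :
    p.map (fun ω => (φ (hist n ω), (ω n).2)) = p.map (fun ω => φ (hist n ω)) ⊗ₘ η := by
  have := Measure.isProbabilityMeasure_map (μ := p) (measurable_hist n).aemeasurable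
  let r : Hist X A (n + 1) → Y × A := fun h =>
    (φ (fun i => h.1 i.castSucc, (h.1 (Fin.last n)).1), (h.1 (Fin.last n)).2)
  have hr : Measurable r := by fun_prop
  have hφ' : Measurable (Prod.map φ (id : A → A)) := hφ.prodMap measurable_id
  have h1 : p.map (fun ω => (φ (hist n ω), (ω n).2)) = (p.map (hist (n + 1))).map r := by
    rw [Measure.map_map hr (measurable_hist _)]
    rfl
  have h2 : r ∘ extendHist = Prod.map φ id ∘ Prod.fst := by
    funext w
    simp [r, extendHist, Prod.map]
  have h3 : p.map (fun ω => φ (hist n ω)) = (p.map (hist n)).map φ := by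
    rw [Measure.map_map hφ (measurable_hist _)]
    rfl
  rw [h1, h3, h.map_hist_succ hη]
  unfold histStep
  rw [Measure.map_map hr (measurable_extendHist n), h2, ← Measure.map_map hφ' measurable_fst,
    ← Measure.fst, Measure.fst_compProd]
  ext B hB
  rw [Measure.map_apply hφ' hB, Measure.compProd_apply (hφ' hB), Measure.compProd_apply hB,
    lintegral_map (Kernel.measurable_kernel_prodMk_left hB) hφ]
  rfl

end Induced

section Rules

variable {X A : Type*} [MeasurableSpace X] [MeasurableSpace A] {Acts : X → Set A}
  {q : Kernel (X × A) X} {N : Prop} {p0 : Measure X}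

theorem Policy.admissibleAt (π : Policy Acts) (hπ : N → π.Nonrandomized) (n : ℕ)
    (h : Hist X A n) : AdmissibleAt Acts N h.2 (π.μ n h) :=
  ⟨π.feasible n h, fun hN => hπ hN n h⟩

theorem Policy.isUMKernel_markov {π : Policy Acts} {m : ℕ → X → Measure A}
    (hm : ∀ n h, π.μ n h = m n h.2) (c : X × A) (n : ℕ) : IsUMKernel (m n) := by
  have := (π.isUMKernel n).comp (f := fun y : X => ((fun _ => c, y) : Hist X A n)) (by fun_prop)
  simpa only [hm] using this

theorem Policy.admissibleAt_markov {π : Policy Acts} (hπ : N → π.Nonrandomized)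
    {m : ℕ → X → Measure A} (hm : ∀ n h, π.μ n h = m n h.2) (c : X × A) (n : ℕ) (y : X) :
    AdmissibleAt Acts N y (m n y) := by
  have := π.admissibleAt hπ n (fun _ => c, y)
  rwa [hm] at this

/-- The policy whose decision at time `n` depends on the initial state and on a feature of the
history that determines the current state. -/
def Policy.ofRules {Y : ℕ → Type*} [∀ n, MeasurableSpace (Y n)] {φ : ∀ n, Hist X A n → Y n}
    (hφ : ∀ n, Measurable (φ n)) {ψ : ∀ n, Y n → X} (hψφ : ∀ n h, ψ n (φ n h) = h.2)
    {κ : ∀ n, X × Y n → Measure A} (hκ : ∀ n, IsUMKernel (κ n))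
    (hκA : ∀ n z, AdmissibleAt Acts N (ψ n z.2) (κ n z)) : Policy Acts where
  μ n h := κ n (firstState h, φ n h)
  isProb n h := (hκ n).isProb _
  umeas n := ((hκ n).comp ((measurable_firstState n).prodMk (hφ n))).umeas
  feasible n h := by simpa only [hψφ] using (hκA n (firstState h, φ n h)).1

theorem Induces.initial_eq {π : Policy Acts} {p : Measure (Traj X A)} (h : Induces q π p0 p) :
    p0 = p.map fun ω => (ω 0).1 := by
  have h0 := congrArg (fun P => P.map Prod.snd) h.map_hist_zero
  rw [Measure.map_map measurable_snd (measurable_hist 0),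
    Measure.map_map measurable_snd (by fun_prop)] at h0
  exact (Measure.map_id (μ := p0)).symm.trans h0.symm

/-- A policy that agrees with `π` once the initial state is frozen at `x` induces the same
strategic measure from `x`. -/
theorem Induces.of_frozen_initial [IsMarkovKernel q] [MeasurableSingletonClass X]
    [MeasurableSpace.CountablyGenerated A] {π π' : Policy Acts} {p : Measure (Traj X A)}
    [IsProbabilityMeasure p] (h : Induces q π p0 p) {x : X}
    (hx : p.map (fun ω => (ω 0).1) = Measure.dirac x)
    (hπ : ∀ n, ∀ᵐ h ∂p.map (hist n), firstState h = x → π'.μ n h = π.μ n h) :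
    Induces q π' (Measure.dirac x) p := by
  rw [← hx, ← h.initial_eq]
  refine h.congr_ae fun n => ?_
  have h0 : ∀ᵐ ω ∂p, (ω 0).1 = x :=
    ae_of_ae_map (f := fun ω : Traj X A => (ω 0).1) (measurable_pi_apply 0).fst.aemeasurable
      (hx ▸ (ae_dirac_iff (measurableSet_singleton x)).2 rfl)
  have hf : ∀ᵐ h ∂p.map (hist n), firstState h = x :=
    (ae_map_iff (measurable_hist n).aemeasurable
      (measurable_firstState n (measurableSet_singleton x))).2
      (h0.mono fun ω hω => (firstState_hist ω n).trans hω)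
  filter_upwards [hπ n, hf] with h h1 h2 using h1 h2

variable {Y : Type*} [MeasurableSpace Y] [MeasurableSpace.CountablyGenerated Y]
  [StandardBorelSpace A]

/-- Reconstruction, from a universally measurable family of strategic measures, of decision rules
that factor through features `φ j` of the histories at times `t j`. -/
theorem exists_rule [IsMarkovKernel q]
    (hΓ : UniversallyMeasurableSet {xa : X × A | xa.2 ∈ Acts xa.1})
    {ζ : X → Measure (Traj X A)} (hζ : IsUMKernel ζ)
    (hπ : X → ∃ π : Policy Acts, N → π.Nonrandomized) (hne : ∀ x, (Acts x).Nonempty)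
    {t : ℕ → ℕ} {φ : ∀ j, Hist X A (t j) → Y} (hφ : ∀ j, Measurable (φ j))
    {ψ : Y → X} (hψ : Measurable ψ) :
    ∃ κ : X × Y → Measure A, IsUMKernel κ ∧ (∀ z, AdmissibleAt Acts N (ψ z.2) (κ z)) ∧
      ∀ (x : X) (π : Policy Acts) (p0 : Measure X) (m : Y → Measure A), Induces q π p0 (ζ x) →
        IsUMKernel m → (∀ y, AdmissibleAt Acts N (ψ y) (m y)) →
        (∀ j h, π.μ (t j) h = m (φ j h)) →
        ∀ j, ∀ᵐ h ∂(ζ x).map (hist (t j)), κ (x, φ j h) = π.μ (t j) h := by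
  rcases isEmpty_or_nonempty X with hX | ⟨⟨x₀⟩⟩
  · exact ⟨fun _ => 0, ⟨fun z => isEmptyElim z.1, fun B _ s _ μ _ => by
      rw [Set.eq_empty_of_isEmpty ((fun _ : X × Y => _) ⁻¹' s)]; exact nullMeasurableSet_empty⟩,
      fun z => isEmptyElim z.1, fun x => isEmptyElim x⟩
  have : Nonempty A := (hne x₀).to_type
  obtain ⟨π₀, hπ₀⟩ := hπ x₀
  have hd : IsUMKernel fun x => π₀.μ 0 (Fin.elim0, x) :=
    (π₀.isUMKernel 0).comp (f := fun x : X => ((Fin.elim0, x) : Hist X A 0)) (by fun_prop)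
  obtain ⟨κ, hκ, hκA, hκeq⟩ := IsUMKernel.exists_admissible_rule (N := N) (ψ := ψ)
    (U := fun j ω => φ j (hist (t j) ω)) (V := fun j ω => (ω (t j)).2) hΓ hd
    (fun x => π₀.admissibleAt hπ₀ 0 (Fin.elim0, x)) hζ
    (fun j => (hφ j).comp (measurable_hist _)) (fun j => by fun_prop) hψ
  refine ⟨κ, hκ, hκA, fun x π p0 m hi hm hmA hπm j => ?_⟩
  have := hζ.isProb x
  have hmap (j : ℕ) : (ζ x).map (fun ω => φ j (hist (t j) ω)) = ((ζ x).map (hist (t j))).map (φ j) :=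
    (Measure.map_map (hφ j) (measurable_hist _)).symm
  have := hκeq x m hm hmA (fun j η _ hη => hi.map_prodMk_action (hφ j) (by
    rw [hmap] at hη
    filter_upwards [ae_of_ae_map (hφ j).aemeasurable hη] with h hh
    rw [hπm, hh, Kernel.comap_apply])) j
  rw [hmap] at this
  filter_upwards [ae_of_ae_map (hφ j).aemeasurable this] with h hh
  rw [hh, hπm]

end Rules

section Realization

variable {X A : Type*} [MeasurableSpace X] [MeasurableSpace A] [StandardBorelSpace X]
  [StandardBorelSpace A] {Acts : X → Set A} {q : Kernel (X × A) X} [IsMarkovKernel q] (N : Prop)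
  {ζ : X → Measure (Traj X A)}

theorem exists_policy_induces (hΓ : UniversallyMeasurableSet {xa : X × A | xa.2 ∈ Acts xa.1})
    (hne : ∀ x, (Acts x).Nonempty) (hζ : IsUMKernel ζ)
    (h : ∀ x, ∃ (π : Policy Acts) (p0 : Measure X), (N → π.Nonrandomized) ∧
      Induces q π p0 (ζ x) ∧ (ζ x).map (fun ω => (ω 0).1) = Measure.dirac x) :
    ∃ π : Policy Acts, (N → π.Nonrandomized) ∧ ∀ x, Induces q π (Measure.dirac x) (ζ x) := by
  choose κ hκ hκA hκeq using fun n : ℕ => exists_rule (N := N) (q := q) (t := fun _ => n)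
    (φ := fun _ h => h) (ψ := Prod.snd) hΓ hζ (fun x => (h x).imp fun π ⟨_, hπ⟩ => hπ.1) hne
    (fun _ => measurable_id) measurable_snd
  refine ⟨Policy.ofRules (fun _ => measurable_id) (fun _ _ => rfl) hκ hκA,
    fun hN n h => (hκA n _).2 hN, fun x => ?_⟩
  obtain ⟨π, p0, hN, hi, hx⟩ := h x
  have := hζ.isProb x
  refine hi.of_frozen_initial hx fun n => ?_
  filter_upwards [hκeq n x π p0 (π.μ n) hi (π.isUMKernel n) (π.admissibleAt hN n)
    (fun _ _ => rfl) 0] with h hh hhx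
  subst hhx
  exact hh

theorem exists_semiMarkov_induces
    (hΓ : UniversallyMeasurableSet {xa : X × A | xa.2 ∈ Acts xa.1})
    (hne : ∀ x, (Acts x).Nonempty) (hζ : IsUMKernel ζ)
    (h : ∀ x, ∃ (π : Policy Acts) (p0 : Measure X), (N → π.Nonrandomized) ∧ π.Markov ∧
      Induces q π p0 (ζ x) ∧ (ζ x).map (fun ω => (ω 0).1) = Measure.dirac x) :
    ∃ π : Policy Acts, (N → π.Nonrandomized) ∧ π.SemiMarkov ∧
      ∀ x, Induces q π (Measure.dirac x) (ζ x) := by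
  choose κ hκ hκA hκeq using fun n : ℕ => exists_rule (N := N) (q := q) (t := fun _ => n)
    (φ := fun _ h => h.2) (ψ := id) hΓ hζ (fun x => (h x).imp fun π ⟨_, hπ⟩ => hπ.1) hne
    (fun _ => measurable_snd) measurable_id
  refine ⟨Policy.ofRules (fun _ => measurable_snd) (fun _ _ => rfl) hκ hκA,
    fun hN n h => (hκA n _).2 hN, ⟨κ, fun _ _ => rfl⟩, fun x => ?_⟩
  obtain ⟨π, p0, hN, ⟨m, hm⟩, hi, hx⟩ := h x
  have := hζ.isProb x
  let c : X × A := (x, (hne x).some)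
  refine hi.of_frozen_initial hx fun n => ?_
  filter_upwards [hκeq n x π p0 (m n) hi (Policy.isUMKernel_markov hm c n)
    (Policy.admissibleAt_markov hN hm c n) (fun _ h => hm n h) 0] with h hh hhx
  subst hhx
  exact hh

theorem exists_semiStationary_induces
    (hΓ : UniversallyMeasurableSet {xa : X × A | xa.2 ∈ Acts xa.1})
    (hne : ∀ x, (Acts x).Nonempty) (hζ : IsUMKernel ζ)
    (h : ∀ x, ∃ (π : Policy Acts) (p0 : Measure X), (N → π.Nonrandomized) ∧ π.Stationary ∧
      Induces q π p0 (ζ x) ∧ (ζ x).map (fun ω => (ω 0).1) = Measure.dirac x) :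
    ∃ π : Policy Acts, (N → π.Nonrandomized) ∧ π.SemiStationary ∧
      ∀ x, Induces q π (Measure.dirac x) (ζ x) := by
  obtain ⟨κ, hκ, hκA, hκeq⟩ := exists_rule (N := N) (q := q) (t := fun j => j)
    (φ := fun _ h => h.2) (ψ := id) hΓ hζ (fun x => (h x).imp fun π ⟨_, hπ⟩ => hπ.1) hne
    (fun _ => measurable_snd) measurable_id
  refine ⟨Policy.ofRules (fun _ => measurable_snd) (fun _ _ => rfl) (fun _ => hκ) (fun _ => hκA),
    fun hN n h => (hκA _).2 hN, ⟨κ, fun _ _ => rfl⟩, fun x => ?_⟩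
  obtain ⟨π, p0, hN, ⟨m, hm⟩, hi, hx⟩ := h x
  have := hζ.isProb x
  let c : X × A := (x, (hne x).some)
  refine hi.of_frozen_initial hx fun n => ?_
  filter_upwards [hκeq x π p0 m hi (Policy.isUMKernel_markov (m := fun _ => m) hm c 0)
    (Policy.admissibleAt_markov (m := fun _ => m) hN hm c 0) hm n] with h hh hhx
  subst hhx
  exact hh

end Realization

/-- Proposition `prp-ummap-pol`: if `ζ : 𝕏 → P(Ω)` is universally
measurable with `ζ(x) ∈ tilde-S_⋆(x)` for all `x`, then there is a policy `π` with
`ρ_x[π] = ζ(x)` for all `x`; for `S_m` (resp. `S_s`) it can be taken semi-Markov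
(resp. semi-stationary); and if `ζ(x) ∈ tilde-S'_⋆(x)` for all `x`, it can be taken
nonrandomized as well. -/
theorem statement2
    {X A : Type*} [TopologicalSpace X] [PolishSpace X] [MeasurableSpace X] [BorelSpace X]
    [TopologicalSpace A] [PolishSpace A] [MeasurableSpace A] [BorelSpace A]
    (q : Kernel (X × A) X) [IsMarkovKernel q] (Acts : X → Set A)
    (hne : ∀ x, (Acts x).Nonempty)
    (hΓ : MeasureTheory.AnalyticSet {xa : X × A | xa.2 ∈ Acts xa.1}) :
    (∀ ζ : X → ProbabilityMeasure (Traj X A), UniversallyMeasurable ζ →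
      (∀ x, ζ x ∈ tsec q Acts (fun _ => True) x) →
      ∃ π : Policy Acts, ∀ x, Induces q π (Measure.dirac x) (ζ x).toMeasure) ∧
    (∀ ζ : X → ProbabilityMeasure (Traj X A), UniversallyMeasurable ζ →
      (∀ x, ζ x ∈ tsec q Acts Policy.Markov x) →
      ∃ π : Policy Acts, π.SemiMarkov ∧
        ∀ x, Induces q π (Measure.dirac x) (ζ x).toMeasure) ∧
    (∀ ζ : X → ProbabilityMeasure (Traj X A), UniversallyMeasurable ζ →
      (∀ x, ζ x ∈ tsec q Acts Policy.Stationary x) →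
      ∃ π : Policy Acts, π.SemiStationary ∧
        ∀ x, Induces q π (Measure.dirac x) (ζ x).toMeasure) ∧
    (∀ ζ : X → ProbabilityMeasure (Traj X A), UniversallyMeasurable ζ →
      (∀ x, ζ x ∈ tsec q Acts Policy.Nonrandomized x) →
      ∃ π : Policy Acts, π.Nonrandomized ∧
        ∀ x, Induces q π (Measure.dirac x) (ζ x).toMeasure) ∧
    (∀ ζ : X → ProbabilityMeasure (Traj X A), UniversallyMeasurable ζ →
      (∀ x, ζ x ∈ tsec q Acts (fun π => π.Markov ∧ π.Nonrandomized) x) →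
      ∃ π : Policy Acts, π.SemiMarkov ∧ π.Nonrandomized ∧
        ∀ x, Induces q π (Measure.dirac x) (ζ x).toMeasure) ∧
    (∀ ζ : X → ProbabilityMeasure (Traj X A), UniversallyMeasurable ζ →
      (∀ x, ζ x ∈ tsec q Acts (fun π => π.Stationary ∧ π.Nonrandomized) x) →
      ∃ π : Policy Acts, π.SemiStationary ∧ π.Nonrandomized ∧
        ∀ x, Induces q π (Measure.dirac x) (ζ x).toMeasure) := by
  have hΓu := hΓ.universallyMeasurableSet
  refine ⟨fun ζ hζ h => ?_, fun ζ hζ h => ?_, fun ζ hζ h => ?_, fun ζ hζ h => ?_,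
    fun ζ hζ h => ?_, fun ζ hζ h => ?_⟩
  · obtain ⟨π, -, hi⟩ := exists_policy_induces (q := q) False hΓu hne hζ.isUMKernel_toMeasure
      fun x => by
        obtain ⟨⟨π, p0, -, hi⟩, hx⟩ := h x
        exact ⟨π, p0.toMeasure, False.elim, hi, hx⟩
    exact ⟨π, hi⟩
  · obtain ⟨π, -, hs, hi⟩ := exists_semiMarkov_induces (q := q) False hΓu hne
      hζ.isUMKernel_toMeasure fun x => by
        obtain ⟨⟨π, p0, hm, hi⟩, hx⟩ := h x
        exact ⟨π, p0.toMeasure, False.elim, hm, hi, hx⟩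
    exact ⟨π, hs, hi⟩
  · obtain ⟨π, -, hs, hi⟩ := exists_semiStationary_induces (q := q) False hΓu hne
      hζ.isUMKernel_toMeasure fun x => by
        obtain ⟨⟨π, p0, hm, hi⟩, hx⟩ := h x
        exact ⟨π, p0.toMeasure, False.elim, hm, hi, hx⟩
    exact ⟨π, hs, hi⟩
  · obtain ⟨π, hN, hi⟩ := exists_policy_induces (q := q) True hΓu hne hζ.isUMKernel_toMeasure
      fun x => by
        obtain ⟨⟨π, p0, hN, hi⟩, hx⟩ := h x
        exact ⟨π, p0.toMeasure, fun _ => hN, hi, hx⟩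
    exact ⟨π, hN trivial, hi⟩
  · obtain ⟨π, hN, hs, hi⟩ := exists_semiMarkov_induces (q := q) True hΓu hne
      hζ.isUMKernel_toMeasure fun x => by
        obtain ⟨⟨π, p0, ⟨hm, hN⟩, hi⟩, hx⟩ := h x
        exact ⟨π, p0.toMeasure, fun _ => hN, hm, hi, hx⟩
    exact ⟨π, hs, hN trivial, hi⟩
  · obtain ⟨π, hN, hs, hi⟩ := exists_semiStationary_induces (q := q) True hΓu hne
      hζ.isUMKernel_toMeasure fun x => by
        obtain ⟨⟨π, p0, ⟨hm, hN⟩, hi⟩, hx⟩ := h x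
        exact ⟨π, p0.toMeasure, fun _ => hN, hm, hi, hx⟩
    exact ⟨π, hs, hN trivial, hi⟩

end PaperStmt
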